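/- Let y be a nonnegative integer and suppose p = 4y^2 + 3y + 1 is a prime with p ≥ 5. Then there does not exist a nontrivial regular (8p^3, 4p^2−2p+4y+1, 2p+8y, 2p−2)-partial difference set in any Abelian group of order 8p^3. -/

import Mathlib

variable {G : Type*} [CommGroup G] [DecidableEq G] [Fintype G]

/-- The number of representations of `g` as `d₁ * d₂⁻¹` with `d₁, d₂ ∈ D`, `d₁ ≠ d₂`. -/
def pdsReps (D : Finset G) (g : G) : ℕ :=
  ((D ×ˢ D).filter (fun x => x.1 ≠ x.2 ∧ x.1 * x.2⁻¹ = g)).card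

/-- `D` is a `(v,k,λ,μ)`-partial difference set in `G`. -/
def IsPDS (D : Finset G) (v k l m : ℕ) : Prop :=
  Fintype.card G = v ∧ D.card = k ∧
  (∀ g : G, g ≠ 1 → g ∈ D → pdsReps D g = l) ∧
  (∀ g : G, g ≠ 1 → g ∉ D → pdsReps D g = m)

/-- `D` is regular: closed under inverses and not containing the identity. -/
def IsRegularPDS (D : Finset G) : Prop :=
  (∀ d ∈ D, d⁻¹ ∈ D) ∧ (1 : G) ∉ D

/-- A regular PDS is trivial if `D ∪ {e}` or `G \ D` is a subgroup. -/
def IsTrivialPDS (D : Finset G) : Prop :=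
  (∃ H : Subgroup G, (H : Set G) = ↑D ∪ {1}) ∨
  (∃ H : Subgroup G, (H : Set G) = (↑D : Set G)ᶜ)

/-- For `g ≠ 1` the number of square roots of `g` in a regular PDS is even when `pdsReps D g` is:
swapping the factors of `g = d₁ * d₂` pairs up the representations with `d₁ ≠ d₂`. -/
theorem even_card_sqrt_of_even_pdsReps {A : Type*} [CommGroup A] [DecidableEq A]
    {D : Finset A} (hD : IsRegularPDS D) {g : A} (hg : g ≠ 1)
    (heven : Even (pdsReps D g)) : Even (D.filter (fun d => d ^ 2 = g)).card := by
  set P := (D ×ˢ D).filter (fun x : A × A => x.1 * x.2 = g) with hP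
  have hreps : pdsReps D g = P.card := by
    refine Finset.card_bij' (fun x _ => (x.1, x.2⁻¹)) (fun x _ => (x.1, x.2⁻¹)) ?_ ?_ ?_ ?_
    · intro x hx
      simp only [hP, Finset.mem_filter, Finset.mem_product] at hx ⊢
      exact ⟨⟨hx.1.1, hD.1 _ hx.1.2⟩, hx.2.2⟩
    · intro x hx
      simp only [hP, Finset.mem_filter, Finset.mem_product, inv_inv] at hx ⊢
      refine ⟨⟨hx.1.1, hD.1 _ hx.1.2⟩, fun h => hg ?_, hx.2⟩
      rw [← hx.2, h, inv_mul_cancel]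
    · simp
    · simp
  have hdiag : (P.filter (fun x => x.1 = x.2)).card = (D.filter (fun d => d ^ 2 = g)).card := by
    refine Finset.card_bij' (fun x _ => x.1) (fun d _ => (d, d)) ?_ ?_ ?_ ?_
    · rintro ⟨a, b⟩ hx
      simp only [hP, Finset.mem_filter, Finset.mem_product] at hx ⊢
      obtain ⟨⟨⟨ha, -⟩, hab⟩, rfl⟩ := hx
      exact ⟨ha, by rw [pow_two, hab]⟩
    · intro d hd
      simp only [hP, Finset.mem_filter, Finset.mem_product] at hd ⊢
      exact ⟨⟨⟨hd.1, hd.1⟩, by rw [← pow_two, hd.2]⟩, trivial⟩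
    · rintro ⟨a, b⟩ hx
      simp only [Finset.mem_filter] at hx
      simp [hx.2]
    · simp
  have hoff : Even (P.filter (fun x => ¬ x.1 = x.2)).card := by
    have hsum : ∑ _x ∈ P.filter (fun x => ¬ x.1 = x.2), (1 : ZMod 2) = 0 := by
      refine Finset.sum_involution (fun x _ => x.swap) ?_ ?_ ?_ ?_
      · intros; decide
      · rintro ⟨a, b⟩ hx - h
        simp only [Finset.mem_filter] at hx
        exact hx.2 (congrArg Prod.snd h)
      · rintro ⟨a, b⟩ hx
        simp only [hP, Finset.mem_filter, Finset.mem_product, Prod.swap_prod_mk] at hx ⊢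
        exact ⟨⟨⟨hx.1.1.2, hx.1.1.1⟩, by rw [mul_comm, hx.1.2]⟩, fun h => hx.2 h.symm⟩
      · simp
    rw [← ZMod.natCast_eq_zero_iff_even]
    simpa using hsum
  rw [hreps, ← Finset.card_filter_add_card_filter_not (s := P) (fun x => x.1 = x.2), hdiag] at heven
  exact (Nat.even_add.mp heven).mpr hoff

/-- The number of pairs in `D` with equal squares is controlled by the number `n` of
solutions of `g ^ 2 = 1`. -/
theorem card_pairs_sq_eq_le {D : Finset G} {l : ℕ} (hl : ∀ g : G, g ≠ 1 → pdsReps D g ≤ l) :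
    ∑ d ∈ D, (D.filter (fun e => e ^ 2 = d ^ 2)).card ≤
      D.card + ((Finset.univ.filter (fun g : G => g ^ 2 = 1)).card - 1) * l := by
  set T := Finset.univ.filter (fun g : G => g ^ 2 = 1) with hT
  set P := (D ×ˢ D).filter (fun x : G × G => x.2 ^ 2 = x.1 ^ 2) with hP
  have hsum : ∑ d ∈ D, (D.filter (fun e => e ^ 2 = d ^ 2)).card = P.card := by
    simp only [hP, Finset.card_filter, Finset.sum_product]
  have hmaps : ∀ x ∈ P, x.1 * x.2⁻¹ ∈ T := by
    intro x hx
    simp only [hP, hT, Finset.mem_filter, Finset.mem_univ, true_and] at hx ⊢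
    rw [mul_pow, inv_pow, hx.2, mul_inv_cancel]
  have hone : (1 : G) ∈ T := by simp [hT]
  rw [hsum, Finset.card_eq_sum_card_fiberwise hmaps, ← Finset.add_sum_erase T _ hone]
  refine add_le_add ?_ ?_
  · refine Finset.card_le_card_of_injOn Prod.fst ?_ ?_
    · intro x hx
      simp only [hP, Finset.coe_filter, Finset.mem_filter, Finset.mem_product,
        Set.mem_ofPred_eq] at hx
      exact hx.1.1.1
    · rintro ⟨a, b⟩ hx ⟨c, d⟩ hy h
      simp only [Finset.coe_filter, Set.mem_ofPred_eq, mul_inv_eq_one] at hx hy h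
      rw [← hx.2, ← hy.2, h]
  · rw [← Finset.card_erase_of_mem hone, ← smul_eq_mul]
    refine Finset.sum_le_card_nsmul _ _ _ fun g hg => ?_
    have hg1 : g ≠ 1 := Finset.ne_of_mem_erase hg
    refine (Finset.card_le_card fun x hx => ?_).trans (hl g hg1)
    simp only [hP, Finset.mem_filter] at hx ⊢
    refine ⟨hx.1.1, fun h => hg1 ?_, hx.2⟩
    rw [← hx.2, h, mul_inv_cancel]

/-- A regular PDS in which all nonidentity elements have an even number, at most `l`, of
representations is small in terms of the number of solutions of `g ^ 2 = 1`. -/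
theorem card_le_of_even_pdsReps {D : Finset G} (hD : IsRegularPDS D) {l : ℕ}
    (hl : ∀ g : G, g ≠ 1 → pdsReps D g ≤ l) (heven : ∀ g : G, g ≠ 1 → Even (pdsReps D g)) :
    D.card ≤ ((Finset.univ.filter (fun g : G => g ^ 2 = 1)).card - 1) * (l + 1) := by
  have hpairs := card_pairs_sq_eq_le hl
  have hinv : (D.filter (fun d => d ^ 2 = 1)).card ≤
      (Finset.univ.filter (fun g : G => g ^ 2 = 1)).card - 1 := by
    rw [← Finset.card_erase_of_mem (a := (1 : G)) (by simp)]
    refine Finset.card_le_card fun d hd => ?_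
    simp only [Finset.mem_filter] at hd
    simp only [Finset.mem_erase, Finset.mem_filter, Finset.mem_univ, true_and]
    exact ⟨fun h => hD.2 (h ▸ hd.1), hd.2⟩
  have hlower : D.card * 2 ≤ ∑ d ∈ D, ((D.filter (fun e => e ^ 2 = d ^ 2)).card +
      if d ^ 2 = 1 then 1 else 0) := by
    rw [← smul_eq_mul]
    refine Finset.card_nsmul_le_sum _ _ _ fun d hd => ?_
    have hpos : 0 < (D.filter (fun e => e ^ 2 = d ^ 2)).card :=
      Finset.card_pos.mpr ⟨d, by simp [hd]⟩
    split_ifs with h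
    · lia
    · obtain ⟨c, hc⟩ := even_card_sqrt_of_even_pdsReps hD h (heven _ h)
      lia
  rw [Finset.sum_add_distrib, ← Finset.card_filter] at hlower
  rw [mul_add, mul_one]
  lia

/-- The number of solutions of `g ^ 2 = 1` is at most the `2`-part of the group order. -/
theorem card_sq_eq_one_le {m n : ℕ} (hG : Fintype.card G = 2 ^ n * m) (hm : Odd m) :
    (Finset.univ.filter (fun g : G => g ^ 2 = 1)).card ≤ 2 ^ n := by
  let T : Subgroup G := (powMonoidHom 2 : G →* G).ker
  have hT : Nat.card T = (Finset.univ.filter (fun g : G => g ^ 2 = 1)).card := by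
    rw [← Nat.card_eq_finsetCard]
    exact Nat.card_congr (Equiv.subtypeEquivRight fun g => by simp [T, MonoidHom.mem_ker])
  have : Fact (Nat.Prime 2) := ⟨Nat.prime_two⟩
  have hp : IsPGroup 2 T := fun g => ⟨1, Subtype.ext (MonoidHom.mem_ker.mp g.2)⟩
  obtain ⟨j, hj⟩ := IsPGroup.iff_card.mp hp
  have hdvd : Nat.card T ∣ 2 ^ n * m := by
    rw [← hG, ← Nat.card_eq_fintype_card]
    exact T.card_subgroup_dvd_card
  rw [← hT]
  refine Nat.le_of_dvd (by positivity) (Nat.Coprime.dvd_of_dvd_mul_right ?_ hdvd)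
  rw [hj]
  exact Nat.Coprime.pow_left _ (Nat.coprime_two_left.mpr hm)

/-- For `p = 4y^2+3y+1 ≥ 5` prime, there is no nontrivial regular
`(8p^3, 4p^2-2p+4y+1, 2p+8y, 2p-2)`-PDS in an Abelian group. -/
theorem no_pds_case3ii (y p : ℕ) (hpy : p = 4 * y ^ 2 + 3 * y + 1)
    (hp : p.Prime) (hp5 : 5 ≤ p)
    {G : Type*} [CommGroup G] [DecidableEq G] [Fintype G]
    (D : Finset G) :
    ¬ (IsPDS D (8 * p ^ 3) (4 * p ^ 2 - 2 * p + 4 * y + 1) (2 * p + 8 * y)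
          (2 * p - 2) ∧
        IsRegularPDS D ∧ ¬ IsTrivialPDS D) := by
  rintro ⟨⟨hG, hk, hl, hm⟩, hD, -⟩
  have hT : (Finset.univ.filter (fun g : G => g ^ 2 = 1)).card ≤ 2 ^ 3 :=
    card_sq_eq_one_le (m := p ^ 3) (by rw [hG]; norm_num)
      (hp.odd_of_ne_two (by lia)).pow
  have hreps : ∀ g : G, g ≠ 1 → pdsReps D g ≤ 2 * p + 8 * y ∧ Even (pdsReps D g) := by
    intro g hg
    rw [even_iff_two_dvd]
    by_cases hgD : g ∈ D
    · rw [hl g hg hgD]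
      lia
    · rw [hm g hg hgD]
      lia
  have hcard := card_le_of_even_pdsReps hD (fun g hg => (hreps g hg).1) fun g hg => (hreps g hg).2
  have hbound := hcard.trans (Nat.mul_le_mul_right (2 * p + 8 * y + 1)
    (show _ ≤ 7 by lia))
  rw [hk] at hbound
  have hy : 2 ≤ y := by
    by_contra! h
    interval_cases y <;> subst hpy <;> revert hp hp5 <;> norm_num
  have hyp : 11 * y + 1 ≤ p := by nlinarith
  have hpp : 23 * p ≤ p ^ 2 := by nlinarith
  lia
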